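/- Fix an integer n ≥ 1 and a real number ε ≠ 0. Inside ℂⁿ, identified with ℝⁿ × ℝⁿ via z = q + ip, the union of the vanishing cycles C_z = √z · S^{n−1} of the standard Lefschetz fibration over the horizontal line {z ∈ ℂ : Im z = ε} equals a Lagrangian handle: { ζ·x : ζ ∈ ℂ, x ∈ ℝⁿ, ‖x‖ = 1, Im(ζ²) = ε } = { q + i p : q, p ∈ ℝⁿ, q ≠ 0, p = (ε/(2‖q‖²)) q }. (Here ζ·x denotes the vector in ℂⁿ with k-th coordinate ζ x_k, so the left-hand set is exactly the union over all z with Im z = ε of the sets √z S^{n−1}.) -/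

import Mathlib

/-- The union of the vanishing cycles `C_z = √z · S^{n-1}` of the standard Lefschetz
fibration over the line `Im z = ε` is the Lagrangian handle `H_{ε/2}`. -/
theorem vanishing_cycles_eq_handle (n : ℕ) (hn : 1 ≤ n) (ε : ℝ) (hε : ε ≠ 0) :
    {z : EuclideanSpace ℂ (Fin n) |
        ∃ (ζ : ℂ) (x : EuclideanSpace ℝ (Fin n)), ‖x‖ = 1 ∧ (ζ ^ 2).im = ε ∧
          ∀ k, z k = ζ * (x k : ℂ)} =
      {z : EuclideanSpace ℂ (Fin n) |
        ∃ q p : EuclideanSpace ℝ (Fin n), q ≠ 0 ∧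
          p = (ε / (2 * ‖q‖ ^ 2)) • q ∧ ∀ k, z k = (q k : ℂ) + (p k : ℂ) * Complex.I} := by
  have im_sq (w : ℂ) : (w ^ 2).im = 2 * w.re * w.im := by
    rw [sq, Complex.mul_im]
    ring
  ext z
  constructor
  · rintro ⟨ζ, x, hx, hζ, hz⟩
    rw [im_sq] at hζ
    have hre : ζ.re ≠ 0 := by
      rintro h
      exact hε (by simp [← hζ, h])
    have hx0 : x ≠ 0 := by
      rintro rfl
      simp at hx
    refine ⟨ζ.re • x, ζ.im • x, smul_ne_zero hre hx0, ?_, fun k => ?_⟩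
    · rw [smul_smul, norm_smul, hx, mul_one, Real.norm_eq_abs, sq_abs, ← hζ]
      congr 1
      field_simp
    · rw [hz k]
      apply Complex.ext <;> simp
  · rintro ⟨q, p, hq, rfl, hz⟩
    have hr : ‖q‖ ≠ 0 := norm_ne_zero_iff.mpr hq
    refine ⟨⟨‖q‖, ε / (2 * ‖q‖)⟩, ‖q‖⁻¹ • q, norm_smul_inv_norm hq, ?_, fun k => ?_⟩
    · rw [im_sq]
      field_simp
    · rw [hz k]
      simp only [PiLp.smul_apply, smul_eq_mul]
      apply Complex.ext <;>
        simp only [Complex.add_re, Complex.add_im, Complex.re_mul_ofReal, Complex.im_mul_ofReal,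
          Complex.re_ofReal_mul, Complex.im_ofReal_mul, Complex.ofReal_re, Complex.ofReal_im,
          Complex.I_re, Complex.I_im] <;>
        field_simp <;> ring
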